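/- Let (Gₙ, φₙ), n ∈ ℕ, be a sequence of central pairs and ω an ultrafilter on ℕ. Then the set N = {(gₙ)ₙ ∈ ∏ₙ Gₙ : lim_{n→ω} φₙ(gₙ) = 1} (the limit taken in ℂ along ω) is a normal subgroup of the cartesian product group ∏ₙ Gₙ. -/

import Mathlib

open Finset ComplexOrder Filter

/-- A function `φ : G → ℂ` is positive definite if for every `n`, every
`g₁,…,gₙ ∈ G` and every `λ₁,…,λₙ ∈ ℂ` the sum `∑ conj(λᵢ) λⱼ φ(gᵢ⁻¹ gⱼ)` is a
nonnegative real number (i.e. nonnegative in the partial order of `ℂ`). -/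
def IsPositiveDefinite {G : Type*} [Group G] (φ : G → ℂ) : Prop :=
  ∀ (n : ℕ) (g : Fin n → G) (lam : Fin n → ℂ),
    0 ≤ ∑ i : Fin n, ∑ j : Fin n,
      (starRingEnd ℂ) (lam i) * lam j * φ ((g i)⁻¹ * g j)

/-- A function `φ : G → ℂ` is central if it is constant on conjugacy classes. -/
def IsCentral {G : Type*} [Group G] (φ : G → ℂ) : Prop :=
  ∀ g h : G, φ (g * h * g⁻¹) = φ h

namespace IsPositiveDefinite

variable {G : Type*} [Group G] {φ : G → ℂ}

theorem map_inv (hφ : IsPositiveDefinite φ) (he : φ 1 = 1) (g : G) :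
    φ g⁻¹ = (starRingEnd ℂ) (φ g) := by
  have h₁ := (Complex.le_def.1 (hφ 2 ![1, g] ![1, 1])).2
  have h₂ := (Complex.le_def.1 (hφ 2 ![1, g] ![1, Complex.I])).2
  simp [Fin.sum_univ_two, he] at h₁ h₂
  apply Complex.ext
  · simp
    linarith
  · simp
    linarith

theorem normSq_le_one (hφ : IsPositiveDefinite φ) (he : φ 1 = 1) (g : G) :
    Complex.normSq (φ g) ≤ 1 := by
  have h := (Complex.le_def.1 (hφ 2 ![1, g] ![-φ g, 1])).1
  simp [Fin.sum_univ_two, he, hφ.map_inv he] at h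
  rw [Complex.normSq_apply]
  linarith

theorem one_sub_re_mul_le (hφ : IsPositiveDefinite φ) (he : φ 1 = 1) (g h : G) :
    1 - (φ (g * h)).re ≤ 2 * (1 - (φ g).re) + 2 * (1 - (φ h).re) := by
  have key := (Complex.le_def.1 (hφ 3 ![g⁻¹, 1, h] ![1, -2, 1])).1
  have hgh : φ (h⁻¹ * g⁻¹) = (starRingEnd ℂ) (φ (g * h)) := by
    rw [← mul_inv_rev, hφ.map_inv he]
  simp [Fin.sum_univ_three, he, hφ.map_inv he, hgh] at key
  linarith

theorem tendsto_one_iff {ι : Type*} {l : Filter ι} {G : ι → Type*} [∀ i, Group (G i)]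
    {φ : ∀ i, G i → ℂ} (hφ : ∀ i, IsPositiveDefinite (φ i)) (he : ∀ i, φ i 1 = 1)
    (g : ∀ i, G i) :
    Tendsto (fun i => φ i (g i)) l (nhds 1) ↔
      Tendsto (fun i => 1 - (φ i (g i)).re) l (nhds 0) := by
  constructor
  · intro h
    simpa using ((Complex.continuous_re.tendsto 1).comp h).const_sub 1
  · intro h
    rw [tendsto_iff_norm_sub_tendsto_zero]
    have hs : Tendsto (fun i => √(2 * (1 - (φ i (g i)).re))) l (nhds 0) := by
      simpa using (h.const_mul 2).sqrt
    refine squeeze_zero (fun _ => norm_nonneg _) (fun i => Real.le_sqrt_of_sq_le ?_) hs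
    have hn := (hφ i).normSq_le_one (he i) (g i)
    rw [← Complex.normSq_eq_norm_sq, Complex.normSq_apply]
    rw [Complex.normSq_apply] at hn
    simp only [Complex.sub_re, Complex.sub_im, Complex.one_re, Complex.one_im]
    linarith

theorem re_le_one (hφ : IsPositiveDefinite φ) (he : φ 1 = 1) (g : G) : (φ g).re ≤ 1 := by
  have h := hφ.normSq_le_one he g
  rw [Complex.normSq_apply] at h
  nlinarith [mul_self_nonneg (φ g).im]

end IsPositiveDefinite

/-- for a sequence of central pairs `(Gₙ, φₙ)` and an ultrafilter
`ω` on `ℕ`, the set `N = {(gₙ)ₙ : lim_{n→ω} φₙ(gₙ) = 1}` is a normal subgroup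
of the cartesian product `∏ₙ Gₙ`. -/
theorem ultraproduct_kernel_normal_subgroup
    (G : ℕ → Type*) [∀ n, Group (G n)] (φ : ∀ n, G n → ℂ)
    (hpd : ∀ n, IsPositiveDefinite (φ n)) (hc : ∀ n, IsCentral (φ n))
    (he : ∀ n, φ n 1 = 1) (ω : Ultrafilter ℕ) :
    ∃ N : Subgroup (∀ n, G n), N.Normal ∧
      (N : Set (∀ n, G n))
        = {g : ∀ n, G n | Tendsto (fun n => φ n (g n)) ω (nhds 1)} := by
  refine ⟨{ carrier := {g | Tendsto (fun n => φ n (g n)) ω (nhds 1)}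
            one_mem' := ?_
            mul_mem' := ?_
            inv_mem' := ?_ }, ⟨?_⟩, rfl⟩
  · intro a b ha hb
    rw [Set.mem_ofPred_eq, IsPositiveDefinite.tendsto_one_iff hpd he] at ha hb ⊢
    refine squeeze_zero (fun n => sub_nonneg.2 ((hpd n).re_le_one (he n) _))
      (fun n => (hpd n).one_sub_re_mul_le (he n) (a n) (b n)) ?_
    simpa using (ha.const_mul 2).add (hb.const_mul 2)
  · simp [he]
  · intro a ha
    rw [Set.mem_ofPred_eq, IsPositiveDefinite.tendsto_one_iff hpd he] at ha ⊢
    simpa [(hpd _).map_inv (he _)] using ha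
  · intro a ha g
    change Tendsto (fun n => φ n (a n)) ω (nhds 1) at ha
    change Tendsto (fun n => φ n (g n * a n * (g n)⁻¹)) ω (nhds 1)
    simpa only [hc _ _ _] using ha
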